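/- arXiv:2111.12865 — 2 statements merged into one kernel-verified Lean document; each statement's English description precedes it below -/
import Mathlib

section
/- Let E be a real inner product space, f : E → ℝ differentiable, convex, and λ-smooth with λ > 0, and let 0 ≤ α ≤ 2/λ. Then the gradient-update map G(w) = w − α·∇f(w) is 1-Lipschitz: for all u, v ∈ E, ‖G(u) − G(v)‖ ≤ ‖u − v‖. -/
open scoped RealInnerProductSpace

section GradientInequalities

variable {E : Type*} [NormedAddCommGroup E] [InnerProductSpace ℝ E] {f : E → ℝ} {f' : E → E}

theorem hasDerivAt_comp_line (hdiff : ∀ x, HasFDerivAt f (innerSL ℝ (f' x)) x)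
    (x d : E) (t : ℝ) :
    HasDerivAt (fun t : ℝ => f (x + t • d)) ⟪f' (x + t • d), d⟫ t := by
  have hline : HasDerivAt (fun t : ℝ => x + t • d) d t := by
    simpa using ((hasDerivAt_id t).smul_const d).const_add x
  exact (hdiff (x + t • d)).comp_hasDerivAt t hline

/-- A differentiable convex function lies above its tangent hyperplanes. -/
theorem add_inner_gradient_le_of_convexOn (hdiff : ∀ x, HasFDerivAt f (innerSL ℝ (f' x)) x)
    (hconv : ConvexOn ℝ Set.univ f) (x d : E) :
    f x + ⟪f' x, d⟫ ≤ f (x + d) := by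
  have hline : ConvexOn ℝ Set.univ (fun t : ℝ => f (x + t • d)) := by
    have h := hconv.comp_affineMap (AffineMap.lineMap x (x + d) : ℝ →ᵃ[ℝ] E)
    simpa [Function.comp_def, AffineMap.lineMap_apply, add_comm] using h
  have h := hline.le_slope_of_hasDerivAt (Set.mem_univ 0) (Set.mem_univ 1) one_pos
    (hasDerivAt_comp_line hdiff x d 0)
  simp only [slope_def_field, zero_smul, one_smul, add_zero, sub_zero, div_one] at h
  linarith

/-- A function with `lam`-Lipschitz gradient lies below its quadratic upper models. -/
theorem le_add_inner_gradient_add_sq (hdiff : ∀ x, HasFDerivAt f (innerSL ℝ (f' x)) x)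
    {lam : ℝ} (hsmooth : ∀ u v, ‖f' u - f' v‖ ≤ lam * ‖u - v‖) (x d : E) :
    f (x + d) ≤ f x + ⟪f' x, d⟫ + lam / 2 * ‖d‖ ^ 2 := by
  have hderiv (t : ℝ) : HasDerivAt
      (fun t : ℝ => f (x + t • d) - t * ⟪f' x, d⟫ - t ^ 2 * (lam / 2 * ‖d‖ ^ 2))
      (⟪f' (x + t • d), d⟫ - ⟪f' x, d⟫ - t * (lam * ‖d‖ ^ 2)) t := by
    refine (((hasDerivAt_comp_line hdiff x d t).sub
      ((hasDerivAt_id t).mul_const ⟪f' x, d⟫)).sub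
      ((hasDerivAt_pow 2 t).mul_const (lam / 2 * ‖d‖ ^ 2))).congr_deriv ?_
    push_cast
    ring
  have hanti := antitoneOn_of_deriv_nonpos (convex_Icc (0 : ℝ) 1)
    (fun t _ => (hderiv t).continuousAt.continuousWithinAt)
    (fun t _ => (hderiv t).differentiableAt.differentiableWithinAt)
    (fun t ht => by
      rw [interior_Icc] at ht
      rw [(hderiv t).deriv, ← inner_sub_left]
      have hlip := hsmooth (x + t • d) x
      rw [add_sub_cancel_left, norm_smul, Real.norm_of_nonneg ht.1.le] at hlip
      have hinner := real_inner_le_norm (f' (x + t • d) - f' x) d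
      have hmul := mul_le_mul_of_nonneg_right hlip (norm_nonneg d)
      linarith)
  have h := hanti (Set.left_mem_Icc.2 zero_le_one) (Set.right_mem_Icc.2 zero_le_one) zero_le_one
  simp only [one_smul, zero_smul, add_zero] at h
  linarith

theorem add_inner_gradient_add_sq_le (hdiff : ∀ x, HasFDerivAt f (innerSL ℝ (f' x)) x)
    (hconv : ConvexOn ℝ Set.univ f) {lam : ℝ} (hlam : 0 < lam)
    (hsmooth : ∀ u v, ‖f' u - f' v‖ ≤ lam * ‖u - v‖) (u v : E) :
    f u + ⟪f' u, v - u⟫ + ‖f' u - f' v‖ ^ 2 / (2 * lam) ≤ f v := by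
  set g := f' u - f' v with hg
  have hlower := add_inner_gradient_le_of_convexOn hdiff hconv u (v - u + lam⁻¹ • g)
  have hupper := le_add_inner_gradient_add_sq hdiff hsmooth v (lam⁻¹ • g)
  rw [show u + (v - u + lam⁻¹ • g) = v + lam⁻¹ • g by abel, inner_add_right,
    real_inner_smul_right] at hlower
  rw [real_inner_smul_right, norm_smul, Real.norm_of_nonneg (inv_nonneg.2 hlam.le)] at hupper
  have hsq : ⟪f' u, g⟫ - ⟪f' v, g⟫ = ‖g‖ ^ 2 := by
    rw [← inner_sub_left, ← hg, real_inner_self_eq_norm_sq]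
  have hcoef : lam⁻¹ * ⟪f' u, g⟫ - lam⁻¹ * ⟪f' v, g⟫ - lam / 2 * (lam⁻¹ * ‖g‖) ^ 2
      = ‖g‖ ^ 2 / (2 * lam) := by
    rw [← mul_sub, hsq]
    field_simp
    ring
  linarith

/-- The gradient of a convex `lam`-smooth function is `1 / lam`-cocoercive. -/
theorem norm_gradient_sub_sq_le_of_convexOn (hdiff : ∀ x, HasFDerivAt f (innerSL ℝ (f' x)) x)
    (hconv : ConvexOn ℝ Set.univ f) {lam : ℝ} (hlam : 0 < lam)
    (hsmooth : ∀ u v, ‖f' u - f' v‖ ≤ lam * ‖u - v‖) (u v : E) :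
    ‖f' u - f' v‖ ^ 2 / lam ≤ ⟪u - v, f' u - f' v⟫ := by
  have huv := add_inner_gradient_add_sq_le hdiff hconv hlam hsmooth u v
  have hvu := add_inner_gradient_add_sq_le hdiff hconv hlam hsmooth v u
  rw [norm_sub_rev] at hvu
  have hinner : ⟪f' u, v - u⟫ + ⟪f' v, u - v⟫ = -⟪u - v, f' u - f' v⟫ := by
    rw [← neg_sub u v, inner_neg_right, real_inner_comm _ (u - v), inner_sub_left]
    ring
  have hhalf : ‖f' u - f' v‖ ^ 2 / lam = 2 * (‖f' u - f' v‖ ^ 2 / (2 * lam)) := by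
    field_simp
  linarith

end GradientInequalities

/-- The gradient-update map of a convex `lam`-smooth function with step size
`α ≤ 2/lam` is `1`-Lipschitz. -/
theorem gradientUpdate_nonexpansive_of_convex_smooth
    {E : Type*} [NormedAddCommGroup E] [InnerProductSpace ℝ E]
    (f : E → ℝ) (f' : E → E)
    (hdiff : ∀ x, HasFDerivAt f (innerSL ℝ (f' x)) x)
    (hconv : ConvexOn ℝ Set.univ f)
    (lam : ℝ) (hlam : 0 < lam)
    (hsmooth : ∀ u v, ‖f' u - f' v‖ ≤ lam * ‖u - v‖)
    (α : ℝ) (hα₀ : 0 ≤ α) (hα : α ≤ 2 / lam) :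
    ∀ u v, ‖(u - α • f' u) - (v - α • f' v)‖ ≤ ‖u - v‖ := by
  intro u v
  have hcoer := norm_gradient_sub_sq_le_of_convexOn hdiff hconv hlam hsmooth u v
  rw [show u - α • f' u - (v - α • f' v) = (u - v) - α • (f' u - f' v) by
    rw [smul_sub]; abel]
  refine le_of_sq_le_sq ?_ (norm_nonneg _)
  rw [norm_sub_sq_real, real_inner_smul_right, norm_smul, Real.norm_of_nonneg hα₀]
  have hstep : α * ‖f' u - f' v‖ ^ 2 ≤ 2 * ⟪u - v, f' u - f' v⟫ :=
    calc α * ‖f' u - f' v‖ ^ 2 ≤ 2 / lam * ‖f' u - f' v‖ ^ 2 := by gcongr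
      _ = 2 * (‖f' u - f' v‖ ^ 2 / lam) := by ring
      _ ≤ 2 * ⟪u - v, f' u - f' v⟫ := by gcongr
  linarith [mul_le_mul_of_nonneg_left hstep hα₀]
end

section
/- Let E be a real inner product space, let f : E → ℝ be differentiable, γ-strongly convex, and λ-smooth with 0 < γ ≤ λ, and let g : E → ℝ be differentiable with ‖∇f(w) − ∇g(w)‖ ≤ ε for all w ∈ E. Suppose 0 ≤ α ≤ 2/(λ + γ) and 2αλγ/(λ+γ) ≥ α⁴λ². Then for all u, v ∈ E, ‖(u − α·∇f(u)) − (v − α·∇g(v))‖ ≤ (1 − αλγ/(λ+γ))·‖u − v‖ + α·ε. -/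
open scoped RealInnerProductSpace

section SmoothStronglyConvex

variable {E : Type*} [NormedAddCommGroup E] [InnerProductSpace ℝ E]

/-- The descent lemma: a function with Lipschitz gradient lies below its quadratic upper model. -/
theorem le_quadratic_of_lipschitz_gradient {f : E → ℝ} {f' : E → E} {lam : ℝ}
    (hdf : ∀ x, HasFDerivAt f (innerSL ℝ (f' x)) x)
    (hsf : ∀ u v, ‖f' u - f' v‖ ≤ lam * ‖u - v‖) (u v : E) :
    f u ≤ f v + ⟪f' v, u - v⟫ + lam / 2 * ‖u - v‖ ^ 2 := by
  set d := u - v with hd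
  let φ : ℝ → ℝ := fun t => f (v + t • d) - t * ⟪f' v, d⟫ - lam / 2 * ‖d‖ ^ 2 * t ^ 2
  have hφ (t : ℝ) : HasDerivAt φ
      (⟪f' (v + t • d), d⟫ - ⟪f' v, d⟫ - lam * ‖d‖ ^ 2 * t) t := by
    have hline : HasDerivAt (fun t : ℝ => v + t • d) d t := by
      simpa using ((hasDerivAt_id t).smul_const d).const_add v
    have hf : HasDerivAt (fun t : ℝ => f (v + t • d)) ⟪f' (v + t • d), d⟫ t := by
      exact (hdf (v + t • d)).comp_hasDerivAt t hline
    have hlin := (hasDerivAt_id t).mul_const ⟪f' v, d⟫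
    have hquad := ((hasDerivAt_id t).pow 2).const_mul (lam / 2 * ‖d‖ ^ 2)
    refine ((hf.sub hlin).sub hquad).congr_deriv ?_
    simp
    ring
  have hanti : AntitoneOn φ (Set.Icc 0 1) := by
    refine antitoneOn_of_deriv_nonpos (convex_Icc 0 1)
      (fun t _ => (hφ t).continuousAt.continuousWithinAt)
      (fun t _ => (hφ t).differentiableAt.differentiableWithinAt) fun t ht => ?_
    rw [interior_Icc] at ht
    rw [(hφ t).deriv, ← inner_sub_left]
    have hlip := hsf (v + t • d) v
    rw [add_sub_cancel_left, norm_smul, Real.norm_of_nonneg ht.1.le] at hlip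
    have hcs := real_inner_le_norm (f' (v + t • d) - f' v) d
    have hmul := mul_le_mul_of_nonneg_right hlip (norm_nonneg d)
    linarith
  have h01 : φ 1 ≤ φ 0 := hanti (by simp) (by simp) zero_le_one
  have hvd : v + d = u := by rw [hd]; abel
  simp only [φ, one_smul, zero_smul, hvd, add_zero] at h01
  linarith

/-- Strong convexity makes the gradient strongly monotone. -/
theorem mul_sq_norm_sub_le_inner_gradient_sub {f : E → ℝ} {f' : E → E} {γ : ℝ}
    (hsc : ∀ u v, f u - f v ≥ ⟪f' v, u - v⟫ + γ / 2 * ‖u - v‖ ^ 2) (u v : E) :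
    γ * ‖u - v‖ ^ 2 ≤ ⟪f' u - f' v, u - v⟫ := by
  have huv := hsc u v
  have hvu := hsc v u
  rw [← neg_sub u v, inner_neg_right, norm_neg] at hvu
  rw [inner_sub_left]
  linarith

/-- Coercivity of the gradient of a smooth and strongly convex function. -/
theorem sq_norm_gradient_sub_add_le {f : E → ℝ} {f' : E → E} {γ lam : ℝ}
    (hdf : ∀ x, HasFDerivAt f (innerSL ℝ (f' x)) x) (hγ : 0 < γ) (hgl : γ ≤ lam)
    (hsc : ∀ u v, f u - f v ≥ ⟪f' v, u - v⟫ + γ / 2 * ‖u - v‖ ^ 2)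
    (hsf : ∀ u v, ‖f' u - f' v‖ ≤ lam * ‖u - v‖) (u v : E) :
    ‖f' u - f' v‖ ^ 2 + lam * γ * ‖u - v‖ ^ 2 ≤ (lam + γ) * ⟪f' u - f' v, u - v⟫ := by
  rcases hgl.eq_or_lt with rfl | hlt
  · have hmono := mul_sq_norm_sub_le_inner_gradient_sub hsc u v
    have hsq := pow_le_pow_left₀ (norm_nonneg _) (hsf u v) 2
    nlinarith
  · have key (a b : E) (t : ℝ) :
        f b + ⟪f' b, a - b⟫ + γ / 2 * ‖a - b‖ ^ 2
          + (t - (lam - γ) / 2 * t ^ 2) * ‖f' a - f' b - γ • (a - b)‖ ^ 2 ≤ f a := by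
      set D := f' a - f' b - γ • (a - b) with hD
      have hlow := hsc (a - t • D) b
      have hupp := le_quadratic_of_lipschitz_gradient hdf hsf (a - t • D) a
      have hDD : ⟪f' a, D⟫ - ⟪f' b, D⟫ - γ * ⟪a - b, D⟫ = ‖D‖ ^ 2 := by
        rw [← real_inner_self_eq_norm_sq, ← inner_sub_left, ← real_inner_smul_left,
          ← inner_sub_left]
      rw [show a - t • D - b = (a - b) - t • D by abel, norm_sub_sq_real, inner_sub_right,
        real_inner_smul_right, real_inner_smul_right, norm_smul, mul_pow, Real.norm_eq_abs,
        sq_abs] at hlow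
      rw [show a - t • D - a = -(t • D) by abel, inner_neg_right, real_inner_smul_right,
        norm_neg, norm_smul, mul_pow, Real.norm_eq_abs, sq_abs] at hupp
      linear_combination hlow + hupp - t * hDD
    have hL : 0 < lam - γ := sub_pos.2 hlt
    have huv := key u v (1 / (lam - γ))
    have hvu := key v u (1 / (lam - γ))
    have hcoef : 1 / (lam - γ) - (lam - γ) / 2 * (1 / (lam - γ)) ^ 2 = 1 / (lam - γ) / 2 := by
      field_simp
      ring
    rw [show f' v - f' u - γ • (v - u) = -(f' u - f' v - γ • (u - v)) by
        rw [← neg_sub u v, smul_neg]; abel,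
      ← neg_sub u v, inner_neg_right, norm_neg, norm_neg] at hvu
    rw [hcoef] at huv hvu
    have hsum : 1 / (lam - γ) * ‖f' u - f' v - γ • (u - v)‖ ^ 2
        ≤ ⟪f' u - f' v, u - v⟫ - γ * ‖u - v‖ ^ 2 := by
      rw [inner_sub_left]
      linarith
    rw [one_div, inv_mul_le_iff₀ hL, norm_sub_sq_real (f' u - f' v), real_inner_smul_right,
      norm_smul, mul_pow, Real.norm_eq_abs, sq_abs] at hsum
    linarith

/-- A gradient step with step size at most `2 / (lam + γ)` is a contraction. -/
theorem norm_gradient_step_sub_le {f : E → ℝ} {f' : E → E} {γ lam α : ℝ}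
    (hdf : ∀ x, HasFDerivAt f (innerSL ℝ (f' x)) x) (hγ : 0 < γ) (hgl : γ ≤ lam)
    (hsc : ∀ u v, f u - f v ≥ ⟪f' v, u - v⟫ + γ / 2 * ‖u - v‖ ^ 2)
    (hsf : ∀ u v, ‖f' u - f' v‖ ≤ lam * ‖u - v‖)
    (hα₀ : 0 ≤ α) (hα : α ≤ 2 / (lam + γ)) (u v : E) :
    ‖(u - α • f' u) - (v - α • f' v)‖ ≤ (1 - α * lam * γ / (lam + γ)) * ‖u - v‖ := by
  have hs : 0 < lam + γ := by linarith
  have hαs : α * (lam + γ) ≤ 2 := (le_div_iff₀ hs).1 hα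
  have hx : α * lam * γ / (lam + γ) ≤ 1 := by
    rw [div_le_one hs]
    nlinarith [mul_le_mul_of_nonneg_right hαs hs.le, mul_nonneg hα₀ (sq_nonneg (lam - γ)),
      mul_le_mul_of_nonneg_right hαs hγ.le, mul_nonneg hα₀ (sq_nonneg γ)]
  have hco := sq_norm_gradient_sub_add_le hdf hγ hgl hsc hsf u v
  have hinner : α * lam * γ / (lam + γ) * ‖u - v‖ ^ 2 + α / (lam + γ) * ‖f' u - f' v‖ ^ 2
      ≤ α * ⟪f' u - f' v, u - v⟫ := by
    have hmul := mul_le_mul_of_nonneg_left hco (div_nonneg hα₀ hs.le)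
    have hr : α / (lam + γ) * ((lam + γ) * ⟪f' u - f' v, u - v⟫)
        = α * ⟪f' u - f' v, u - v⟫ := by
      field_simp
    rw [hr] at hmul
    linear_combination hmul
  have hquad : α ^ 2 * ‖f' u - f' v‖ ^ 2 ≤ 2 * (α / (lam + γ) * ‖f' u - f' v‖ ^ 2) := by
    have hmul := mul_le_mul_of_nonneg_left hα hα₀
    have := mul_le_mul_of_nonneg_right hmul (sq_nonneg ‖f' u - f' v‖)
    linear_combination this
  refine abs_le_of_sq_le_sq' ?_ (mul_nonneg (sub_nonneg.2 hx) (norm_nonneg _)) |>.2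
  rw [show (u - α • f' u) - (v - α • f' v) = (u - v) - α • (f' u - f' v) by
      rw [smul_sub]; abel,
    norm_sub_sq_real, real_inner_smul_right, real_inner_comm, norm_smul, mul_pow,
    Real.norm_eq_abs, sq_abs]
  nlinarith [sq_nonneg (α * lam * γ / (lam + γ) * ‖u - v‖)]

end SmoothStronglyConvex

/-- Second case of the perturbed SGD step analysis in the strongly convex regime. -/
theorem perturbed_gradientUpdate_case_two
    {E : Type*} [NormedAddCommGroup E] [InnerProductSpace ℝ E]
    (f g : E → ℝ) (f' g' : E → E)
    (hdf : ∀ x, HasFDerivAt f (innerSL ℝ (f' x)) x)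
    (hdg : ∀ x, HasFDerivAt g (innerSL ℝ (g' x)) x)
    (γ lam : ℝ) (hγ : 0 < γ) (hgl : γ ≤ lam)
    (hsc : ∀ u v, f u - f v ≥ ⟪f' v, u - v⟫ + γ / 2 * ‖u - v‖ ^ 2)
    (hsf : ∀ u v, ‖f' u - f' v‖ ≤ lam * ‖u - v‖)
    (ε : ℝ) (hfg : ∀ w, ‖f' w - g' w‖ ≤ ε)
    (α : ℝ) (hα₀ : 0 ≤ α) (hα : α ≤ 2 / (lam + γ))
    (hcase : α ^ 4 * lam ^ 2 ≤ 2 * α * lam * γ / (lam + γ)) :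
    ∀ u v, ‖(u - α • f' u) - (v - α • g' v)‖ ≤
      (1 - α * lam * γ / (lam + γ)) * ‖u - v‖ + α * ε := by
  intro u v
  have hstep := norm_gradient_step_sub_le hdf hγ hgl hsc hsf hα₀ hα u v
  have hpert : ‖α • (f' v - g' v)‖ ≤ α * ε := by
    rw [norm_smul, Real.norm_of_nonneg hα₀]
    exact mul_le_mul_of_nonneg_left (hfg v) hα₀
  rw [show (u - α • f' u) - (v - α • g' v)
      = ((u - α • f' u) - (v - α • f' v)) - α • (f' v - g' v) by rw [smul_sub]; abel]
  exact (norm_sub_le _ _).trans (add_le_add hstep hpert)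
end
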